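/- For any Martin-Löf BP random real X, if the limit lim_{n→∞} card(X ∩ [[n]])/n exists, then it equals 1/2. -/

import Mathlib

namespace BP



/-- The finite binary string `(X 0, …, X (n−1))`. -/
def take (X : ℕ → Bool) (n : ℕ) : List Bool := (List.range n).map X

/-- `X ∈ [G]`: the real `X` extends some string of the finite set (list) `G`. -/
def Mem (X : ℕ → Bool) (G : List (List Bool)) : Prop :=
  ∃ τ ∈ G, take X τ.length = τ

/-- The maximum length of a string in `G`. -/
def maxLen (G : List (List Bool)) : ℕ := (G.map List.length).foldr max 0

/-- The list of all binary strings of length `L`. -/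
def allStrings (L : ℕ) : List (List Bool) :=
  (List.range (2 ^ L)).map fun k => (List.range L).map fun i => k.testBit i

/-- The uniform (fair-coin) measure of the clopen set `[G]`, computed by counting
which strings of length `maxLen G` extend a member of `G`. -/
def mu (G : List (List Bool)) : ℚ :=
  (((allStrings (maxLen G)).filter fun σ => G.any fun τ => decide (τ <+: σ)).length : ℚ)
    / 2 ^ maxLen G

/-- The uniform measure of `[G] ∩ [τ]`. -/
def muCap (G : List (List Bool)) (τ : List Bool) : ℚ :=
  (((allStrings (max (maxLen G) τ.length)).filter fun σ =>
      decide (τ <+: σ) && (G.any fun ρ => decide (ρ <+: σ))).length : ℚ)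
    / 2 ^ max (maxLen G) τ.length

/-- A primitive recursive test: a primitive recursive sequence of finite sets of
binary strings with `μ([Gₙ]) ≤ 2⁻ⁿ`. -/
def IsTest (G : ℕ → List (List Bool)) : Prop :=
  Primrec G ∧ ∀ n, mu (G n) ≤ ((2 : ℚ) ^ n)⁻¹

/-- `X` is Martin-Löf BP random. -/
def MLBPRandom (X : ℕ → Bool) : Prop :=
  ∀ G : ℕ → List (List Bool), IsTest G → ∃ n, ¬ Mem X (G n)

/-- A weak primitive recursive test. -/
def IsWeakTest (G : ℕ → List (List Bool)) : Prop :=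
  IsTest G ∧ ∃ ℓ : ℕ → ℕ, Primrec ℓ ∧ (∀ n, ∀ τ ∈ G n, τ.length = ℓ n) ∧
    ∀ n, ∀ τ ∈ G n, muCap (G (n + 1)) τ ≤ (1 / 2) * ((2 : ℚ) ^ τ.length)⁻¹

/-- A martingale with values in the nonnegative rationals. -/
def IsMartingale (d : List Bool → ℚ) : Prop :=
  d [] = 1 ∧ (∀ σ, 0 ≤ d σ) ∧
    ∀ σ, d σ = (d (σ ++ [false]) + d (σ ++ [true])) / 2

/-- The martingale `d` succeeds primitive recursively on `X`. -/
def SucceedsPR (d : List Bool → ℚ) (X : ℕ → Bool) : Prop :=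
  ∃ f : ℕ → ℕ, Primrec f ∧ ∀ n, (2 : ℚ) ^ n ≤ d (take X (f n))

/-- `X` is martingale BP random. -/
def MartingaleBPRandom (X : ℕ → Bool) : Prop :=
  ¬ ∃ d : List Bool → ℚ, Primrec d ∧ IsMartingale d ∧ SucceedsPR d X

/-- `X` is primitive recursively compressed by the machine `M`. -/
def CompressedBy (M : List Bool → List Bool) (X : ℕ → Bool) : Prop :=
  ∃ f : ℕ → ℕ, Primrec f ∧
    ∀ c, ∃ σ : List Bool, σ.length ≤ f c - c ∧ M σ = take X (f c)

/-- `X` is Kolmogorov BP random. -/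
def KolmogorovBPRandom (X : ℕ → Bool) : Prop :=
  ¬ ∃ M : List Bool → List Bool, Primrec M ∧ CompressedBy M X

/-- `M` is a (total) process machine: it is extension preserving. -/
def IsProcessMachine (M : List Bool → List Bool) : Prop :=
  ∀ σ τ : List Bool, σ <+: τ → M σ <+: M τ

/-- `M` is a quick process BP machine. -/
def IsQuickProcessBP (M : List Bool → List Bool) : Prop :=
  Primrec M ∧ IsProcessMachine M ∧
    ∃ h : ℕ → ℕ, Primrec h ∧ Monotone h ∧ (∀ k, ∃ n, k ≤ h n) ∧
      ∀ τ : List Bool, h τ.length ≤ (M τ).length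

/-- `X` is quick process BP random. -/
def QuickProcessBPRandom (X : ℕ → Bool) : Prop :=
  ¬ ∃ M : List Bool → List Bool, IsQuickProcessBP M ∧ CompressedBy M X

/-- The number of `i < n` with `X i = true`. -/
def cardBelow (X : ℕ → Bool) (n : ℕ) : ℕ := (List.range n).countP X

/-- The list of all binary strings of length `m`, by recursion on `m`. -/
def strings (m : ℕ) : List (List Bool) :=
  Nat.rec [[]] (fun _ l => l.flatMap fun σ => [false :: σ, true :: σ]) m

theorem strings_succ (m : ℕ) :
    strings (m + 1) = (strings m).flatMap fun σ => [false :: σ, true :: σ] := rfl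

theorem mem_strings {m : ℕ} {σ : List Bool} : σ ∈ strings m ↔ σ.length = m := by
  induction m generalizing σ with
  | zero => simp [strings]
  | succ m ih =>
    rw [strings_succ]
    simp only [List.mem_flatMap, ih, List.mem_cons, List.not_mem_nil, or_false]
    constructor
    · rintro ⟨τ, hτ, rfl | rfl⟩ <;> simp [hτ]
    · intro h
      match σ, h with
      | false :: τ, h => exact ⟨τ, by simpa using h, Or.inl rfl⟩
      | true :: τ, h => exact ⟨τ, by simpa using h, Or.inr rfl⟩

theorem primrec_strings : Primrec strings := by
  refine Primrec.nat_rec₁ [[]] ?_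
  refine Primrec.list_flatMap Primrec.snd ?_
  have hc (b : Bool) : Primrec fun p : (ℕ × List (List Bool)) × List Bool => b :: p.2 :=
    Primrec.list_cons.comp (Primrec.const b) Primrec.snd
  exact Primrec.list_cons.comp (hc false)
    (Primrec.list_cons.comp (hc true) (Primrec.const []))

theorem length_of_mem_allStrings {m : ℕ} {σ : List Bool} (h : σ ∈ allStrings m) :
    σ.length = m := by
  simp only [allStrings, List.mem_map] at h
  obtain ⟨k, -, rfl⟩ := h
  simp

theorem nodup_allStrings (m : ℕ) : (allStrings m).Nodup := by
  refine List.Nodup.map_on ?_ List.nodup_range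
  intro x hx y hy hxy
  rw [List.mem_range] at hx hy
  refine Nat.eq_of_testBit_eq fun i => ?_
  by_cases hi : i < m
  · exact List.map_inj_left.1 hxy i (List.mem_range.2 hi)
  · have hp : 2 ^ m ≤ 2 ^ i := Nat.pow_le_pow_right (by norm_num) (by omega)
    rw [Nat.testBit_lt_two_pow (hx.trans_le hp), Nat.testBit_lt_two_pow (hy.trans_le hp)]

theorem countP_allStrings_le (m : ℕ) (p : List Bool → Bool) :
    (allStrings m).countP p ≤ (strings m).countP p :=
  ((nodup_allStrings m).subperm fun _ hσ =>
    mem_strings.2 (length_of_mem_allStrings hσ)).countP_le p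

theorem maxLen_eq {G : List (List Bool)} {m : ℕ} (hG : ∀ τ ∈ G, τ.length = m) (hne : G ≠ []) :
    maxLen G = m := by
  induction G with
  | nil => exact absurd rfl hne
  | cons τ G ih =>
    have h1 : τ.length = m := hG τ (by simp)
    by_cases hG' : G = []
    · subst hG'
      simp [maxLen, h1]
    · have h2 := ih (fun ρ hρ => hG ρ (List.mem_cons_of_mem _ hρ)) hG'
      simp only [maxLen, List.map_cons, List.foldr_cons] at h2 ⊢
      rw [h2, h1, max_self]

theorem mu_filter_strings_le (m : ℕ) (p : List Bool → Bool) :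
    mu ((strings m).filter p) ≤ ((strings m).countP p : ℚ) / 2 ^ m := by
  by_cases hne : (strings m).filter p = []
  · rw [hne]
    simp only [mu, List.any_nil, List.filter_false, List.length_nil, Nat.cast_zero, zero_div]
    positivity
  · have hlen : ∀ τ ∈ (strings m).filter p, τ.length = m := fun τ hτ =>
      mem_strings.1 (List.mem_filter.1 hτ).1
    rw [mu, maxLen_eq hlen hne, ← List.countP_eq_length_filter]
    gcongr
    refine le_trans (List.countP_mono_left fun σ hσ h => ?_) (countP_allStrings_le m p)
    simp only [List.any_eq_true, decide_eq_true_eq] at h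
    obtain ⟨τ, hτ, hpre⟩ := h
    have : τ = σ := hpre.eq_of_length (by rw [hlen τ hτ, length_of_mem_allStrings hσ])
    exact this ▸ (List.mem_filter.1 hτ).2

/-- The sum over all strings of length `m` of the product weight giving `a` to the bit `b` and
`c` to its complement. -/
theorem sum_weight_strings (a c : ℚ) (b : Bool) (m : ℕ) :
    ((strings m).map fun σ => a ^ σ.count b * c ^ σ.count (!b)).sum = (a + c) ^ m := by
  induction m with
  | zero => simp [strings]
  | succ m ih =>
    rw [strings_succ, List.map_flatMap, pow_succ, ← ih, ← List.sum_map_mul_right]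
    generalize strings m = l
    induction l with
    | nil => simp
    | cons σ l ihl =>
      rw [List.flatMap_cons, List.sum_append, ihl, List.map_cons, List.sum_cons]
      congr 1
      cases b <;> simp [pow_succ] <;> ring

theorem countP_mul_le_sum {α : Type*} (l : List α) (p : α → Bool) (f : α → ℚ) (K : ℚ)
    (h0 : ∀ x, 0 ≤ f x) (hK : ∀ x ∈ l, p x → K ≤ f x) :
    (l.countP p : ℚ) * K ≤ (l.map f).sum := by
  induction l with
  | nil => simp
  | cons x l ih =>
    have h1 := ih fun y hy => hK y (List.mem_cons_of_mem _ hy)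
    rw [List.map_cons, List.sum_cons, List.countP_cons]
    by_cases hp : p x
    · have := hK x (by simp) hp
      simp only [hp, if_true]
      push_cast
      linarith
    · have := h0 x
      simp only [hp]
      simpa using by linarith

theorem count_add_count_not (σ : List Bool) (b : Bool) :
    σ.count b + σ.count (!b) = σ.length := by
  cases b <;> simp

/-- The relative frequency of `b` in `σ` is at least `1 / 2 + 1 / (2 * q)`. -/
def isBiased (q : ℕ) (b : Bool) (σ : List Bool) : Bool :=
  decide ((q + 1) * σ.length ≤ 2 * q * σ.count b)

theorem primrec_count (b : Bool) : Primrec fun σ : List Bool => σ.count b := by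
  have hp : PrimrecPred fun x : Bool => x = b :=
    Primrec.eq.comp Primrec.id (Primrec.const b)
  refine (Primrec.list_length.comp (Primrec.listFilter hp)).of_eq fun σ => ?_
  rw [List.count, List.countP_eq_length_filter]
  congr 2

theorem primrecPred_isBiased (q : ℕ) (b : Bool) : PrimrecPred fun σ => isBiased q b σ = true := by
  have : PrimrecPred fun σ : List Bool => (q + 1) * σ.length ≤ 2 * q * σ.count b :=
    Primrec.nat_le.comp (Primrec.nat_mul.comp (Primrec.const _) Primrec.list_length)
      (Primrec.nat_mul.comp (Primrec.const _) (primrec_count b))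
  exact this.of_eq fun σ => by simp [isBiased]

/-- The weight of a biased string grows exponentially with its length. -/
theorem pow_le_weight {a c : ℚ} (hc : 0 < c) (hca : c ≤ a) {q t s : ℕ}
    (h : (q + 1) * (t + s) ≤ 2 * q * t) :
    ((a * c) ^ q * (a / c)) ^ (t + s) ≤ (a ^ t * c ^ s) ^ (2 * q) := by
  obtain ⟨x, rfl⟩ : ∃ x, a = x * c := ⟨a / c, by field_simp⟩
  have hx : 1 ≤ x := by
    by_contra! hlt
    nlinarith
  have h1 : ((x * c * c) ^ q * (x * c / c)) ^ (t + s)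
      = x ^ ((q + 1) * (t + s)) * c ^ (2 * q * (t + s)) := by
    rw [mul_div_assoc, div_self hc.ne']
    ring
  have h2 : ((x * c) ^ t * c ^ s) ^ (2 * q) = x ^ (2 * q * t) * c ^ (2 * q * (t + s)) := by
    ring
  rw [h1, h2]
  gcongr

theorem one_lt_growth {q : ℕ} (hq : 3 ≤ q) :
    (1 : ℚ) < ((1 + 1 / (q : ℚ)) * (1 - 1 / q)) ^ q * ((1 + 1 / (q : ℚ)) / (1 - 1 / q)) := by
  have hq' : (3 : ℚ) ≤ q := by exact_mod_cast hq
  set d : ℚ := 1 / q with hd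
  have hd0 : 0 < d := by positivity
  have hqd : (q : ℚ) * d = 1 := by rw [hd]; field_simp
  have hd1 : d ≤ 1 / 3 := by nlinarith
  have h1 : 1 - d ≤ ((1 + d) * (1 - d)) ^ q := by
    have := one_add_mul_le_pow (a := -d ^ 2) (by nlinarith) q
    calc 1 - d = 1 + q * -d ^ 2 := by linear_combination d * hqd
      _ ≤ _ := this
      _ = _ := by ring
  calc (1 : ℚ) < 1 + d := by linarith
    _ = (1 - d) * ((1 + d) / (1 - d)) := by
      have : 1 - d ≠ 0 := by linarith
      field_simp
    _ ≤ _ := by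
      have : 0 < 1 - d := by linarith
      gcongr

theorem exists_countP_isBiased_le {q : ℕ} (hq : 3 ≤ q) :
    ∃ k : ℕ, 0 < k ∧ ∀ (b : Bool) (n : ℕ),
      ((strings (k * n)).countP (isBiased q b) : ℚ) * 2 ^ n ≤ 2 ^ (k * n) := by
  have hq' : (3 : ℚ) ≤ q := by exact_mod_cast hq
  obtain ⟨e, he⟩ := pow_unbounded_of_one_lt 2 (one_lt_growth hq)
  have he0 : 0 < e := by
    rcases Nat.eq_zero_or_pos e with rfl | h
    · norm_num at he
    · exact h
  have hd0 : (0 : ℚ) < 1 / q := by positivity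
  have hd1 : (1 : ℚ) / q < 1 := by
    rw [div_lt_one] <;> linarith
  refine ⟨2 * q * e, by positivity, fun b n => ?_⟩
  have hsum := sum_weight_strings (1 + 1 / (q : ℚ)) (1 - 1 / q) b (2 * q * e * n)
  rw [show (1 + 1 / (q : ℚ)) + (1 - 1 / q) = 2 by ring] at hsum
  rw [← hsum]
  have ha : (0 : ℚ) < 1 + 1 / q := by linarith
  have hc : (0 : ℚ) < 1 - 1 / q := by linarith
  refine countP_mul_le_sum _ _ _ _ (fun σ => by positivity) fun σ hσ hb => ?_
  rw [mem_strings] at hσ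
  rw [isBiased, decide_eq_true_eq, ← count_add_count_not σ b] at hb
  rw [← count_add_count_not σ b] at hσ
  have hw := pow_le_weight hc (by linarith : 1 - 1 / (q : ℚ) ≤ 1 + 1 / q) hb
  refine le_of_pow_le_pow_left₀ (n := 2 * q) (by omega) (by positivity) (le_trans ?_ hw)
  rw [hσ, show 2 * q * e * n = e * (n * (2 * q)) by ring, ← pow_mul, pow_mul _ e]
  gcongr

@[simp]
theorem length_take (X : ℕ → Bool) (n : ℕ) : (take X n).length = n := by simp [take]

/-- A random real is not eventually biased towards a bit `b`. -/
theorem MLBPRandom.not_eventually_isBiased {X : ℕ → Bool} (hX : MLBPRandom X) {q : ℕ}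
    (hq : 3 ≤ q) (b : Bool) : ¬ ∃ N, ∀ n ≥ N, isBiased q b (take X n) := by
  rintro ⟨N, hN⟩
  obtain ⟨k, hk, hle⟩ := exists_countP_isBiased_le hq
  have hG : IsTest fun n => (strings (k * (n + N))).filter (isBiased q b) := by
    refine ⟨?_, fun n => ?_⟩
    · have hm : Primrec fun n => strings (k * (n + N)) :=
        primrec_strings.comp (Primrec.nat_mul.comp (Primrec.const k)
          (Primrec.nat_add.comp Primrec.id (Primrec.const N)))
      refine ((Primrec.listFilter (primrecPred_isBiased q b)).comp hm).of_eq fun n => ?_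
      simp
    · refine (mu_filter_strings_le _ _).trans ?_
      rw [div_le_iff₀ (by positivity), inv_mul_eq_div, le_div_iff₀ (by positivity)]
      refine le_trans ?_ (hle b (n + N))
      gcongr
      · norm_num
      · omega
  obtain ⟨n, hn⟩ := hX _ hG
  refine hn ⟨take X (k * (n + N)), List.mem_filter.2 ⟨mem_strings.2 (length_take _ _), hN _ ?_⟩,
    by rw [length_take]⟩
  nlinarith

theorem count_true_take (X : ℕ → Bool) (n : ℕ) : (take X n).count true = cardBelow X n := by
  rw [take, List.count, List.countP_map, cardBelow]
  congr 1
  funext i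
  simp

theorem exists_nat_gap {ε : ℝ} (hε : 0 < ε) : ∃ q : ℕ, 3 ≤ q ∧ 1 / (2 * (q : ℝ)) < ε := by
  obtain ⟨k, hk⟩ := exists_nat_gt (1 / ε)
  refine ⟨k + 3, by omega, ?_⟩
  rw [div_lt_iff₀ hε] at hk
  rw [div_lt_iff₀ (by positivity)]
  push_cast
  nlinarith

theorem stmt10 (X : ℕ → Bool) (hX : MLBPRandom X) (L : ℝ)
    (h : Filter.Tendsto (fun n => (cardBelow X n : ℝ) / (n : ℝ)) Filter.atTop (nhds L)) :
    L = 1 / 2 := by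
  rcases lt_trichotomy L (1 / 2) with hL | hL | hL
  · obtain ⟨q, hq, hgap⟩ := exists_nat_gap (sub_pos.2 hL)
    refine absurd ?_ (hX.not_eventually_isBiased hq false)
    obtain ⟨N, hN⟩ := Filter.eventually_atTop.1
      (h.eventually_lt_const (show L < 1 / 2 - 1 / (2 * (q : ℝ)) by linarith))
    refine ⟨N + 1, fun n hn => ?_⟩
    have h1 := hN n (by omega)
    have hn0 : (0 : ℝ) < n := by exact_mod_cast (show 0 < n by omega)
    have hq0 : (0 : ℝ) < q := by exact_mod_cast (show 0 < q by omega)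
    have h2 := count_add_count_not (take X n) true
    rw [count_true_take, length_take, Bool.not_true] at h2
    rw [isBiased, decide_eq_true_eq, length_take]
    rw [div_lt_iff₀ hn0] at h1
    have h3 : (cardBelow X n : ℝ) + (take X n).count false = n := by exact_mod_cast h2
    have h4 : 2 * (q : ℝ) * ((1 / 2 - 1 / (2 * (q : ℝ))) * n) = (q - 1) * n := by
      field_simp
    have h5 : 2 * (q : ℝ) * cardBelow X n ≤ (q - 1) * n := by
      rw [← h4]
      gcongr
    have h6 : ((q : ℝ) + 1) * n ≤ 2 * q * (take X n).count false := by
      linear_combination h5 - 2 * (q : ℝ) * h3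
    exact_mod_cast h6
  · exact hL
  · obtain ⟨q, hq, hgap⟩ := exists_nat_gap (sub_pos.2 hL)
    refine absurd ?_ (hX.not_eventually_isBiased hq true)
    obtain ⟨N, hN⟩ := Filter.eventually_atTop.1
      (h.eventually_const_lt (show 1 / 2 + 1 / (2 * (q : ℝ)) < L by linarith))
    refine ⟨N + 1, fun n hn => ?_⟩
    have h1 := hN n (by omega)
    have hn0 : (0 : ℝ) < n := by exact_mod_cast (show 0 < n by omega)
    have hq0 : (0 : ℝ) < q := by exact_mod_cast (show 0 < q by omega)
    rw [isBiased, decide_eq_true_eq, length_take, count_true_take]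
    rw [lt_div_iff₀ hn0] at h1
    have h4 : 2 * (q : ℝ) * ((1 / 2 + 1 / (2 * (q : ℝ))) * n) = (q + 1) * n := by
      field_simp
    have h5 : ((q : ℝ) + 1) * n ≤ 2 * q * cardBelow X n := by
      rw [← h4]
      gcongr
    exact_mod_cast h5

end BP
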